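/- arXiv:2512.11491 — 2 statements merged into one kernel-verified Lean document; each statement's English description precedes it below -/
import Mathlib

section
/- For every Θ > 0, any minimizer (u,v) of m_Θ (i.e. (u,v) ∈ V_Θ with I(u,v) = m_Θ) is a weak solution of the coupled system: there exist λ₁, λ₂ ∈ ℝ such that for every smooth compactly supported test function φ on ℝ³ × 𝕋, ∫_{ℝ³×𝕋}(∇_{x,y}u·∇_{x,y}φ + λ₁ u φ) dx dy = ∫_{ℝ³×𝕋}(u³ + u v²)φ dx dy and ∫_{ℝ³×𝕋}(∇_{x,y}v·∇_{x,y}φ + λ₂ v φ) dx dy = ∫_{ℝ³×𝕋}(v³ + v u²)φ dx dy. -/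
noncomputable section

open MeasureTheory Real Filter

namespace Waveguide

/-- A point of the waveguide `ℝ³ × 𝕋`, modelled as `ℝ³ × ℝ` with functions that are
`2π`-periodic in the second coordinate. -/
abbrev Pt : Type := (Fin 3 → ℝ) × ℝ

/-- The fundamental domain `ℝ³ × (0, 2π]` of the waveguide `ℝ³ × 𝕋`. -/
def Dom : Set Pt := Set.univ ×ˢ Set.Ioc 0 (2 * π)

/-- `2π`-periodicity in the `y` variable. -/
def PeriodicY (u : Pt → ℝ) : Prop := ∀ x y, u (x, y + 2 * π) = u (x, y)

/-- The `i`-th horizontal coordinate direction. -/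
def ex (i : Fin 3) : Pt := (fun j => if j = i then 1 else 0, 0)

/-- The vertical (periodic) direction. -/
def ey : Pt := (0, 1)

/-- `i`-th partial derivative in the `x` variables. -/
def gradx (u : Pt → ℝ) (p : Pt) (i : Fin 3) : ℝ := fderiv ℝ u p (ex i)

/-- Partial derivative in the `y` variable, `u_y`. -/
def grady (u : Pt → ℝ) (p : Pt) : ℝ := fderiv ℝ u p ey

/-- `|∇_x u|²`. -/
def gradSqX (u : Pt → ℝ) (p : Pt) : ℝ := ∑ i, (gradx u p i) ^ 2

/-- `|∇_{x,y} u|²`. -/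
def gradSq (u : Pt → ℝ) (p : Pt) : ℝ := gradSqX u p + (grady u p) ^ 2

/-- Membership in (a regular repesentative of) `H¹(ℝ³ × 𝕋)`, for real valued functions. -/
structure H1 (u : Pt → ℝ) : Prop where
  periodic : PeriodicY u
  diff : Differentiable ℝ u
  memL2 : IntegrableOn (fun p => (u p) ^ 2) Dom
  memGrad : IntegrableOn (fun p => gradSq u p) Dom
  memL4 : IntegrableOn (fun p => (u p) ^ 4) Dom

/-- The `L²(ℝ³ × 𝕋)` norm. -/
def l2 (u : Pt → ℝ) : ℝ := Real.sqrt (∫ p in Dom, (u p) ^ 2)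

/-- `u ∈ S_Θ`. -/
def inS (Θ : ℝ) (u : Pt → ℝ) : Prop := H1 u ∧ l2 u = Θ

/-- The nonlinear density `u⁴ + 2u²v² + v⁴`. -/
def nonlin (u v : Pt → ℝ) (p : Pt) : ℝ :=
  (u p) ^ 4 + 2 * (u p) ^ 2 * (v p) ^ 2 + (v p) ^ 4

/-- The energy functional `I(u,v)`. -/
def energy (u v : Pt → ℝ) : ℝ :=
  (1 / 2) * (∫ p in Dom, (gradSq u p + gradSq v p))
    - (1 / 4) * ∫ p in Dom, nonlin u v p

/-- The semivirial functional `Q(u,v)`. -/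
def svirial (u v : Pt → ℝ) : ℝ :=
  (∫ p in Dom, (gradSqX u p + gradSqX v p))
    - (3 / 4) * ∫ p in Dom, nonlin u v p

/-- The ground-state level `m_Θ`. -/
def mlevel (Θ : ℝ) : ℝ :=
  sInf {c | ∃ u v : Pt → ℝ, inS Θ u ∧ inS Θ v ∧ svirial u v = 0 ∧ energy u v = c}

/-- `(u,v)` is a minimizer of `m_Θ`: it lies in `V_Θ` and attains the infimum. -/
def isMinimizer (Θ : ℝ) (u v : Pt → ℝ) : Prop :=
  inS Θ u ∧ inS Θ v ∧ svirial u v = 0 ∧ energy u v = mlevel Θ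

/-- Smooth, compactly supported (in `x`) test function on the waveguide. -/
def TestFun (φ : Pt → ℝ) : Prop :=
  ContDiff ℝ (⊤ : ℕ∞) φ ∧ PeriodicY φ ∧
    ∃ K : Set (Fin 3 → ℝ), IsCompact K ∧ ∀ p : Pt, p.1 ∉ K → φ p = 0

/-- `u` is a weak solution of `-Δ_{x,y} u + lam u = f` on `ℝ³ × 𝕋`. -/
def WeakSol (lam : ℝ) (u f : Pt → ℝ) : Prop :=
  ∀ φ : Pt → ℝ, TestFun φ →
    (∫ p in Dom,
        ((∑ i, gradx u p i * gradx φ p i) + grady u p * grady φ p + lam * u p * φ p))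
      = ∫ p in Dom, f p * φ p

/-- The mass-preserving rescaling `u^τ(x,y) = τ^{3/2} u(τx, y)`. -/
def scaleX (τ : ℝ) (u : Pt → ℝ) : Pt → ℝ :=
  fun p => τ ^ ((3 : ℝ) / 2) * u (τ • p.1, p.2)

/-- `u` is independent of the `y` variable, i.e. `u_y = 0` (a.e.). -/
def Yindep (u : Pt → ℝ) : Prop := ∀ᵐ p : Pt ∂volume, grady u p = 0

/-- The functional `J_μ(u,v)`. -/
def Jfun (μ : ℝ) (u v : Pt → ℝ) : ℝ :=
  (1 / 2) * (∫ p in Dom,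
      (gradSqX u p + μ * (grady u p) ^ 2 + gradSqX v p + μ * (grady v p) ^ 2))
    - (1 / 4) * ∫ p in Dom, nonlin u v p

/-- The level `m_{1,μ}`. -/
def m1 (μ : ℝ) : ℝ :=
  sInf {c | ∃ u v : Pt → ℝ, inS 1 u ∧ inS 1 v ∧ svirial u v = 0 ∧ Jfun μ u v = c}

/-- `(u,v)` is a minimizer of `m_{1,μ}`. -/
def isMinimizerJ (μ : ℝ) (u v : Pt → ℝ) : Prop :=
  inS 1 u ∧ inS 1 v ∧ svirial u v = 0 ∧ Jfun μ u v = m1 μ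

/-! ### Objects on `ℝ³` -/

abbrev Pt3 : Type := Fin 3 → ℝ

def e3 (i : Fin 3) : Pt3 := fun j => if j = i then 1 else 0

def grad3 (w : Pt3 → ℝ) (x : Pt3) (i : Fin 3) : ℝ := fderiv ℝ w x (e3 i)

def gradSq3 (w : Pt3 → ℝ) (x : Pt3) : ℝ := ∑ i, (grad3 w x i) ^ 2

/-- Membership in (a regular representative of) `H¹(ℝ³)`. -/
structure H1R3 (w : Pt3 → ℝ) : Prop where
  diff : Differentiable ℝ w
  memL2 : Integrable (fun x => (w x) ^ 2)
  memGrad : Integrable (fun x => gradSq3 w x)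
  memL4 : Integrable (fun x => (w x) ^ 4)

/-- The `L²(ℝ³)` norm. -/
def l2R3 (w : Pt3 → ℝ) : ℝ := Real.sqrt (∫ x, (w x) ^ 2)

def nonlin3 (u v : Pt3 → ℝ) (x : Pt3) : ℝ :=
  (u x) ^ 4 + 2 * (u x) ^ 2 * (v x) ^ 2 + (v x) ^ 4

/-- The limit energy `Î(u,v)` on `ℝ³`. -/
def Ihat (u v : Pt3 → ℝ) : ℝ :=
  (1 / 2) * (∫ x, (gradSq3 u x + gradSq3 v x)) - (1 / 4) * ∫ x, nonlin3 u v x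

/-- The virial `Q̂(u,v)` on `ℝ³`. -/
def Qhat (u v : Pt3 → ℝ) : ℝ :=
  (∫ x, (gradSq3 u x + gradSq3 v x)) - (3 / 4) * ∫ x, nonlin3 u v x

/-- The ground-state energy `m̂_ρ` on `ℝ³`. -/
def mhat (ρ : ℝ) : ℝ :=
  sInf {c | ∃ u v : Pt3 → ℝ, H1R3 u ∧ H1R3 v ∧ l2R3 u = ρ ∧ l2R3 v = ρ ∧
    Qhat u v = 0 ∧ Ihat u v = c}


lemma measurable_gradx {u : Pt → ℝ} (i : Fin 3) : Measurable fun p => gradx u p i :=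
  measurable_fderiv_apply_const ℝ u (ex i)

lemma measurable_grady {u : Pt → ℝ} : Measurable (grady u) :=
  measurable_fderiv_apply_const ℝ u ey

lemma measurable_gradSqX {u : Pt → ℝ} : Measurable (gradSqX u) :=
  Finset.measurable_sum _ fun i _ => (measurable_gradx i).pow_const 2

lemma gradSqX_nonneg (u : Pt → ℝ) (p : Pt) : 0 ≤ gradSqX u p :=
  Finset.sum_nonneg fun _ _ => sq_nonneg _

/-- Pairing of the horizontal gradients. -/
def gradDotX (u φ : Pt → ℝ) (p : Pt) : ℝ := ∑ i, gradx u p i * gradx φ p i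

lemma measurable_gradDotX {u φ : Pt → ℝ} : Measurable (gradDotX u φ) :=
  Finset.measurable_sum _ fun i _ => (measurable_gradx i).mul (measurable_gradx i)

lemma abs_gradDotX_le (u φ : Pt → ℝ) (p : Pt) :
    |gradDotX u φ p| ≤ gradSqX u p + gradSqX φ p := by
  unfold gradDotX gradSqX
  rw [← Finset.sum_add_distrib]
  refine (Finset.abs_sum_le_sum_abs _ _).trans (Finset.sum_le_sum fun i _ => ?_)
  rw [abs_le]
  constructor <;> nlinarith [sq_nonneg (gradx u p i + gradx φ p i),
    sq_nonneg (gradx u p i - gradx φ p i), sq_nonneg (gradx u p i), sq_nonneg (gradx φ p i)]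

lemma gradx_add_smul {u φ : Pt → ℝ} (hu : Differentiable ℝ u) (hφ : Differentiable ℝ φ)
    (s : ℝ) (p : Pt) (i : Fin 3) :
    gradx (fun q => u q + s * φ q) p i = gradx u p i + s * gradx φ p i := by
  unfold gradx
  rw [fderiv_fun_add (hu p) ((hφ p).const_mul s), fderiv_const_mul (hφ p)]
  simp

lemma grady_add_smul {u φ : Pt → ℝ} (hu : Differentiable ℝ u) (hφ : Differentiable ℝ φ)
    (s : ℝ) (p : Pt) :
    grady (fun q => u q + s * φ q) p = grady u p + s * grady φ p := by
  unfold grady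
  rw [fderiv_fun_add (hu p) ((hφ p).const_mul s), fderiv_const_mul (hφ p)]
  simp

lemma gradSqX_add_smul {u φ : Pt → ℝ} (hu : Differentiable ℝ u) (hφ : Differentiable ℝ φ)
    (s : ℝ) (p : Pt) :
    gradSqX (fun q => u q + s * φ q) p
      = gradSqX u p + 2 * s * gradDotX u φ p + s ^ 2 * gradSqX φ p := by
  unfold gradSqX gradDotX
  rw [Finset.mul_sum, Finset.mul_sum, ← Finset.sum_add_distrib, ← Finset.sum_add_distrib]
  refine Finset.sum_congr rfl fun i _ => ?_
  rw [gradx_add_smul hu hφ]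
  ring

section Integrability

variable {u v φ : Pt → ℝ}

lemma H1.meas (hu : H1 u) : Measurable u := hu.diff.continuous.measurable

lemma H1.integrable_gradSqX (hu : H1 u) : IntegrableOn (fun p => gradSqX u p) Dom := by
  refine hu.memGrad.mono' measurable_gradSqX.aestronglyMeasurable (ae_of_all _ fun p => ?_)
  rw [Real.norm_eq_abs, abs_of_nonneg (gradSqX_nonneg u p), gradSq]
  nlinarith [sq_nonneg (grady u p)]

lemma H1.integrable_grady_sq (hu : H1 u) : IntegrableOn (fun p => grady u p ^ 2) Dom := by
  refine hu.memGrad.mono' (measurable_grady.pow_const 2).aestronglyMeasurable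
    (ae_of_all _ fun p => ?_)
  rw [Real.norm_eq_abs, abs_of_nonneg (sq_nonneg _), gradSq]
  linarith [gradSqX_nonneg u p]

lemma H1.integrable_gradDotX (hu : H1 u) (hφ : H1 φ) :
    IntegrableOn (fun p => gradDotX u φ p) Dom :=
  (hu.integrable_gradSqX.add hφ.integrable_gradSqX).mono'
    measurable_gradDotX.aestronglyMeasurable (ae_of_all _ fun p => abs_gradDotX_le u φ p)

lemma abs_mul_le_sq_add_sq (a b : ℝ) : |a * b| ≤ a ^ 2 + b ^ 2 := by
  rw [abs_le]
  constructor <;> nlinarith [sq_nonneg (a + b), sq_nonneg (a - b), sq_nonneg a, sq_nonneg b]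

lemma H1.integrable_grady_mul (hu : H1 u) (hφ : H1 φ) :
    IntegrableOn (fun p => grady u p * grady φ p) Dom :=
  (hu.integrable_grady_sq.add hφ.integrable_grady_sq).mono'
    (measurable_grady.mul measurable_grady).aestronglyMeasurable
    (ae_of_all _ fun _ => abs_mul_le_sq_add_sq _ _)

lemma H1.integrable_mul (hu : H1 u) (hφ : H1 φ) : IntegrableOn (fun p => u p * φ p) Dom :=
  (hu.memL2.add hφ.memL2).mono' (hu.meas.mul hφ.meas).aestronglyMeasurable
    (ae_of_all _ fun _ => abs_mul_le_sq_add_sq _ _)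

/-- A product of four `L⁴` functions is integrable. -/
lemma H1.integrable_mul_mul {w z : Pt → ℝ} (hu : H1 u) (hv : H1 v) (hw : H1 w) (hz : H1 z) :
    IntegrableOn (fun p => (u p * v p) * (w p * z p)) Dom := by
  refine (((hu.memL4.add hv.memL4).add (hw.memL4.add hz.memL4))).mono'
    ((hu.meas.mul hv.meas).mul (hw.meas.mul hz.meas)).aestronglyMeasurable
    (ae_of_all _ fun p => ?_)
  have key : ∀ a b : ℝ, (a * b) ^ 2 ≤ a ^ 4 + b ^ 4 := fun a b => by
    nlinarith [sq_nonneg (a ^ 2 - b ^ 2), sq_nonneg (a ^ 2), sq_nonneg (b ^ 2),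
      sq_nonneg (a ^ 2 + b ^ 2)]
  exact (abs_mul_le_sq_add_sq _ _).trans (add_le_add (key _ _) (key _ _))

end Integrability

lemma H1.add_smul {u φ : Pt → ℝ} (hu : H1 u) (hφ : H1 φ) (s : ℝ) :
    H1 (fun p => u p + s * φ p) where
  periodic x y := by simp only [hu.periodic x y, hφ.periodic x y]
  diff := hu.diff.add (hφ.diff.const_mul s)
  memL2 := by
    refine ((hu.memL2.add ((hu.integrable_mul hφ).const_mul (2 * s))).add
      (hφ.memL2.const_mul (s ^ 2))).congr (ae_of_all _ fun p => ?_)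
    simp only [Pi.add_apply]
    ring
  memGrad := by
    refine ((hu.memGrad.add (((hu.integrable_gradDotX hφ).add
      (hu.integrable_grady_mul hφ)).const_mul (2 * s))).add
      (hφ.memGrad.const_mul (s ^ 2))).congr (ae_of_all _ fun p => ?_)
    simp only [Pi.add_apply, gradSq, gradSqX_add_smul hu.diff hφ.diff,
      grady_add_smul hu.diff hφ.diff]
    ring
  memL4 := by
    have h1 := (hu.integrable_mul_mul hu hu hφ).const_mul (4 * s)
    have h2 := (hu.integrable_mul_mul hu hφ hφ).const_mul (6 * s ^ 2)
    have h3 := (hu.integrable_mul_mul hφ hφ hφ).const_mul (4 * s ^ 3)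
    refine ((((hu.memL4.add h1).add h2).add h3).add (hφ.memL4.const_mul (s ^ 4))).congr
      (ae_of_all _ fun p => ?_)
    simp only [Pi.add_apply]
    ring

section TestFunctions

variable {φ : Pt → ℝ}

lemma integrableOn_Dom_of_continuous {f : Pt → ℝ} (hf : Continuous f) {K : Set (Fin 3 → ℝ)}
    (hK : IsCompact K) (h0 : ∀ p : Pt, p.1 ∉ K → f p = 0) : IntegrableOn f Dom := by
  have hc : IsCompact (K ×ˢ Set.Icc (0 : ℝ) (2 * π)) := hK.prod isCompact_Icc
  refine (hf.continuousOn.integrableOn_compact hc).of_forall_sdiff_eq_zero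
    (MeasurableSet.univ.prod measurableSet_Ioc) fun p hp => h0 p fun hpK => hp.2 ?_
  exact ⟨hpK, Set.Ioc_subset_Icc_self hp.1.2⟩

lemma TestFun.h1 (h : TestFun φ) : H1 φ := by
  obtain ⟨hd, hper, K, hK, h0⟩ := h
  have hcont : Continuous φ := hd.continuous
  have hfd : Continuous (fderiv ℝ φ) := hd.continuous_fderiv (by simp)
  have hfd0 : ∀ p : Pt, p.1 ∉ K → fderiv ℝ φ p = 0 := by
    intro p hp
    have hev : φ =ᶠ[nhds p] fun _ => 0 :=
      Filter.mem_of_superset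
        ((hK.isClosed.isOpen_compl.preimage continuous_fst).mem_nhds hp) h0
    rw [hev.fderiv_eq]
    simp
  refine ⟨hper, hd.differentiable (by simp), ?_, ?_, ?_⟩
  · exact integrableOn_Dom_of_continuous (hcont.pow 2) hK fun p hp => by simp [h0 p hp]
  · refine integrableOn_Dom_of_continuous ?_ hK fun p hp => by
      simp [gradSq, gradSqX, gradx, grady, hfd0 p hp]
    unfold gradSq gradSqX gradx grady
    fun_prop
  · exact integrableOn_Dom_of_continuous (hcont.pow 4) hK fun p hp => by simp [h0 p hp]

end TestFunctions

section Scaling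

/-- The horizontal dilation `(x, y) ↦ (τ x, y)`. -/
def dilX (τ : ℝ) (p : Pt) : Pt := (τ • p.1, p.2)

lemma dilX_eq (τ : ℝ) : dilX τ = Prod.map (τ • ·) id := rfl

lemma measurableEmbedding_dilX {τ : ℝ} (hτ : 0 < τ) : MeasurableEmbedding (dilX τ) := by
  rw [dilX_eq]
  exact (measurableEmbedding_const_smul₀ hτ.ne').prodMap MeasurableEmbedding.id

lemma map_dilX {τ : ℝ} (hτ : 0 < τ) :
    Measure.map (dilX τ) (volume.restrict Dom)
      = ENNReal.ofReal ((τ ^ 3)⁻¹) • (volume.restrict Dom : Measure Pt) := by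
  have hD : (volume.restrict Dom : Measure Pt)
      = (volume : Measure (Fin 3 → ℝ)).prod (volume.restrict (Set.Ioc 0 (2 * π))) := by
    rw [Dom, Measure.volume_eq_prod, ← Measure.prod_restrict, Measure.restrict_univ]
  rw [hD, dilX_eq, ← Measure.map_prod_map _ _ (measurable_const_smul τ) measurable_id,
    Measure.map_id, Measure.map_addHaar_smul _ hτ.ne', Measure.prod_smul_left]
  simp [abs_of_pos hτ]

variable {τ : ℝ} {f : Pt → ℝ}

lemma integral_comp_dilX (hτ : 0 < τ) (f : Pt → ℝ) :
    ∫ p in Dom, f (dilX τ p) = (τ ^ 3)⁻¹ * ∫ p in Dom, f p := by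
  rw [← (measurableEmbedding_dilX hτ).integral_map, map_dilX hτ, integral_smul_measure,
    ENNReal.toReal_ofReal (by positivity), smul_eq_mul]

lemma integrableOn_comp_dilX (hτ : 0 < τ) (hf : IntegrableOn f Dom) :
    IntegrableOn (fun p => f (dilX τ p)) Dom := by
  refine ((measurableEmbedding_dilX hτ).integrable_map_iff (g := f)).1 ?_
  rw [map_dilX hτ]
  exact hf.smul_measure ENNReal.ofReal_ne_top

/-- The rescaled function `a u(τ x, y)`. -/
def resc (a τ : ℝ) (u : Pt → ℝ) (p : Pt) : ℝ := a * u (dilX τ p)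

variable {u v : Pt → ℝ}

lemma hasFDerivAt_resc (hu : Differentiable ℝ u) (a τ : ℝ) (p : Pt) :
    HasFDerivAt (resc a τ u)
      (a • (fderiv ℝ u (dilX τ p)).comp
        ((τ • ContinuousLinearMap.fst ℝ (Fin 3 → ℝ) ℝ).prod
          (ContinuousLinearMap.snd ℝ (Fin 3 → ℝ) ℝ))) p := by
  have h1 : HasFDerivAt (dilX τ) ((τ • ContinuousLinearMap.fst ℝ (Fin 3 → ℝ) ℝ).prod
      (ContinuousLinearMap.snd ℝ (Fin 3 → ℝ) ℝ)) p :=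
    ((τ • ContinuousLinearMap.fst ℝ (Fin 3 → ℝ) ℝ).prod
      (ContinuousLinearMap.snd ℝ (Fin 3 → ℝ) ℝ)).hasFDerivAt
  exact ((hu (dilX τ p)).hasFDerivAt.comp p h1).const_mul a

lemma gradx_resc (hu : Differentiable ℝ u) (a τ : ℝ) (p : Pt) (i : Fin 3) :
    gradx (resc a τ u) p i = a * τ * gradx u (dilX τ p) i := by
  have h : ((τ • ContinuousLinearMap.fst ℝ (Fin 3 → ℝ) ℝ).prod
      (ContinuousLinearMap.snd ℝ (Fin 3 → ℝ) ℝ)) (ex i) = τ • ex i := by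
    ext <;> simp [ex]
  rw [gradx, (hasFDerivAt_resc hu a τ p).fderiv, smul_apply,
    ContinuousLinearMap.comp_apply, h, map_smul, gradx, smul_eq_mul, smul_eq_mul, mul_assoc]

lemma grady_resc (hu : Differentiable ℝ u) (a τ : ℝ) (p : Pt) :
    grady (resc a τ u) p = a * grady u (dilX τ p) := by
  have h : ((τ • ContinuousLinearMap.fst ℝ (Fin 3 → ℝ) ℝ).prod
      (ContinuousLinearMap.snd ℝ (Fin 3 → ℝ) ℝ)) ey = ey := by
    ext <;> simp [ey]
  rw [grady, (hasFDerivAt_resc hu a τ p).fderiv, smul_apply,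
    ContinuousLinearMap.comp_apply, h, grady, smul_eq_mul]

lemma gradSqX_resc (hu : Differentiable ℝ u) (a τ : ℝ) (p : Pt) :
    gradSqX (resc a τ u) p = a ^ 2 * τ ^ 2 * gradSqX u (dilX τ p) := by
  simp only [gradSqX, gradx_resc hu, Finset.mul_sum]
  exact Finset.sum_congr rfl fun i _ => by ring

lemma H1.resc (hu : H1 u) (a : ℝ) (hτ : 0 < τ) : H1 (resc a τ u) where
  periodic x y := by
    simp only [Waveguide.resc, dilX]
    rw [hu.periodic]
  diff p := (hasFDerivAt_resc hu.diff a τ p).differentiableAt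
  memL2 := ((integrableOn_comp_dilX hτ hu.memL2).const_mul (a ^ 2)).congr
    (ae_of_all _ fun p => by simp only [Waveguide.resc]; ring)
  memGrad := (((integrableOn_comp_dilX hτ hu.integrable_gradSqX).const_mul (a ^ 2 * τ ^ 2)).add
    ((integrableOn_comp_dilX hτ hu.integrable_grady_sq).const_mul (a ^ 2))).congr
    (ae_of_all _ fun p => by
      simp only [Pi.add_apply, gradSq, gradSqX_resc hu.diff, grady_resc hu.diff]
      ring)
  memL4 := ((integrableOn_comp_dilX hτ hu.memL4).const_mul (a ^ 4)).congr
    (ae_of_all _ fun p => by simp only [Waveguide.resc]; ring)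

lemma integral_resc_pow (hτ : 0 < τ) (a : ℝ) (u : Pt → ℝ) (n : ℕ) :
    ∫ p in Dom, resc a τ u p ^ n = a ^ n * (τ ^ 3)⁻¹ * ∫ p in Dom, u p ^ n := by
  rw [mul_assoc, ← integral_comp_dilX hτ (fun p => u p ^ n), ← integral_const_mul]
  simp only [resc, mul_pow]

lemma integral_resc_sq_mul_sq (hτ : 0 < τ) (a b : ℝ) (u v : Pt → ℝ) :
    ∫ p in Dom, resc a τ u p ^ 2 * resc b τ v p ^ 2
      = a ^ 2 * b ^ 2 * (τ ^ 3)⁻¹ * ∫ p in Dom, u p ^ 2 * v p ^ 2 := by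
  rw [mul_assoc, ← integral_comp_dilX hτ (fun p => u p ^ 2 * v p ^ 2), ← integral_const_mul]
  congr 1
  ext p
  simp only [resc]
  ring

lemma integral_gradSqX_resc (hu : H1 u) (hτ : 0 < τ) (a : ℝ) :
    ∫ p in Dom, gradSqX (resc a τ u) p
      = a ^ 2 * τ ^ 2 * (τ ^ 3)⁻¹ * ∫ p in Dom, gradSqX u p := by
  rw [mul_assoc, ← integral_comp_dilX hτ (gradSqX u), ← integral_const_mul]
  simp only [gradSqX_resc hu.diff]

lemma integral_grady_sq_resc (hu : H1 u) (hτ : 0 < τ) (a : ℝ) :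
    ∫ p in Dom, grady (resc a τ u) p ^ 2
      = a ^ 2 * (τ ^ 3)⁻¹ * ∫ p in Dom, grady u p ^ 2 := by
  rw [mul_assoc, ← integral_comp_dilX hτ (fun p => grady u p ^ 2), ← integral_const_mul]
  simp only [grady_resc hu.diff, mul_pow]

end Scaling

section Functionals

variable {u v : Pt → ℝ}

lemma H1.integrable_sq_mul_sq (hu : H1 u) (hv : H1 v) :
    IntegrableOn (fun p => u p ^ 2 * v p ^ 2) Dom :=
  (hu.integrable_mul_mul hu hv hv).congr (ae_of_all _ fun p => by ring)

lemma integral_nonlin (hu : H1 u) (hv : H1 v) :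
    ∫ p in Dom, nonlin u v p = (∫ p in Dom, u p ^ 4)
      + 2 * (∫ p in Dom, u p ^ 2 * v p ^ 2) + ∫ p in Dom, v p ^ 4 := by
  rw [← integral_const_mul, ← integral_add hu.memL4 ((hu.integrable_sq_mul_sq hv).const_mul 2),
    ← integral_add (f := fun p => u p ^ 4 + 2 * (u p ^ 2 * v p ^ 2))
      (Integrable.add hu.memL4 ((hu.integrable_sq_mul_sq hv).const_mul 2)) hv.memL4]
  congr 1
  ext p
  simp only [nonlin]
  ring

lemma integral_gradSq (hu : H1 u) :
    ∫ p in Dom, gradSq u p = (∫ p in Dom, gradSqX u p) + ∫ p in Dom, grady u p ^ 2 :=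
  integral_add hu.integrable_gradSqX hu.integrable_grady_sq

lemma svirial_eq (hu : H1 u) (hv : H1 v) :
    svirial u v = (∫ p in Dom, gradSqX u p) + (∫ p in Dom, gradSqX v p)
      - (3 / 4) * ∫ p in Dom, nonlin u v p := by
  rw [svirial, integral_add hu.integrable_gradSqX hv.integrable_gradSqX]

lemma energy_eq (hu : H1 u) (hv : H1 v) :
    energy u v = (1 / 2) * ((∫ p in Dom, gradSqX u p) + (∫ p in Dom, gradSqX v p)
      + ((∫ p in Dom, grady u p ^ 2) + ∫ p in Dom, grady v p ^ 2))
      - (1 / 4) * ∫ p in Dom, nonlin u v p := by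
  rw [energy, integral_add hu.memGrad hv.memGrad, integral_gradSq hu, integral_gradSq hv]
  ring

lemma svirial_comm (u v : Pt → ℝ) : svirial u v = svirial v u := by
  simp only [svirial, nonlin]
  congr 2 <;> (congr 1; ext p; ring)

lemma energy_comm (u v : Pt → ℝ) : energy u v = energy v u := by
  simp only [energy, nonlin]
  congr 2 <;> (congr 1; ext p; ring)

/-- The semivirial constraint makes the energy nonnegative, so the infimum is a lower bound. -/
lemma mlevel_le {Θ : ℝ} (hu : inS Θ u) (hv : inS Θ v) (hQ : svirial u v = 0) :
    mlevel Θ ≤ energy u v := by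
  refine csInf_le ⟨0, ?_⟩ ⟨u, v, hu, hv, hQ, rfl⟩
  rintro c ⟨u, v, ⟨hu, -⟩, ⟨hv, -⟩, hQ, rfl⟩
  rw [svirial_eq hu hv] at hQ
  rw [energy_eq hu hv]
  have h1 : 0 ≤ ∫ p in Dom, gradSqX u p := integral_nonneg (gradSqX_nonneg u)
  have h2 : 0 ≤ ∫ p in Dom, gradSqX v p := integral_nonneg (gradSqX_nonneg v)
  have h3 : 0 ≤ ∫ p in Dom, grady u p ^ 2 := integral_nonneg fun p => sq_nonneg _
  have h4 : 0 ≤ ∫ p in Dom, grady v p ^ 2 := integral_nonneg fun p => sq_nonneg _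
  linarith

lemma l2_eq_iff {Θ : ℝ} (hΘ : 0 < Θ) : l2 u = Θ ↔ ∫ p in Dom, u p ^ 2 = Θ ^ 2 := by
  rw [l2, Real.sqrt_eq_iff_eq_sq (integral_nonneg fun p => sq_nonneg _) hΘ.le]

/-- Normalizing the mass of `u` and dilating horizontally until the semivirial vanishes bounds
the ground state level by an explicit quotient. -/
lemma mlevel_le_quotient {Θ k X Y N : ℝ} (hΘ : 0 < Θ) (hu : H1 u) (hv : inS Θ v)
    (hM : 0 < ∫ p in Dom, u p ^ 2) (hk : k = Θ ^ 2 / ∫ p in Dom, u p ^ 2)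
    (hX : X = k * (∫ p in Dom, gradSqX u p) + ∫ p in Dom, gradSqX v p)
    (hY : Y = k * (∫ p in Dom, grady u p ^ 2) + ∫ p in Dom, grady v p ^ 2)
    (hN : N = k ^ 2 * (∫ p in Dom, u p ^ 4) + 2 * k * (∫ p in Dom, u p ^ 2 * v p ^ 2)
      + ∫ p in Dom, v p ^ 4)
    (hX0 : 0 < X) (hN0 : 0 < N) :
    mlevel Θ ≤ (8 / 27) * (X ^ 3 / N ^ 2) + (1 / 2) * Y := by
  obtain ⟨hv, hvΘ⟩ := hv
  rw [l2_eq_iff hΘ] at hvΘ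
  have hk0 : 0 < k := hk ▸ by positivity
  obtain ⟨τ, hτdef⟩ : ∃ τ, τ = 4 * X / (3 * N) := ⟨_, rfl⟩
  have hτ : 0 < τ := hτdef ▸ by positivity
  obtain ⟨a, ha⟩ : ∃ a : ℝ, a ^ 2 = k * τ ^ 3 := ⟨√(k * τ ^ 3), Real.sq_sqrt (by positivity)⟩
  obtain ⟨b, hb⟩ : ∃ b : ℝ, b ^ 2 = τ ^ 3 := ⟨√(τ ^ 3), Real.sq_sqrt (by positivity)⟩
  have ha4 : a ^ 4 = k ^ 2 * τ ^ 6 := by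
    rw [show a ^ 4 = (a ^ 2) ^ 2 by ring, ha]; ring
  have hb4 : b ^ 4 = τ ^ 6 := by
    rw [show b ^ 4 = (b ^ 2) ^ 2 by ring, hb]; ring
  have hu' := hu.resc a hτ
  have hv' := hv.resc b hτ
  have hX' : (∫ p in Dom, gradSqX (resc a τ u) p) + (∫ p in Dom, gradSqX (resc b τ v) p)
      = τ ^ 2 * X := by
    rw [integral_gradSqX_resc hu hτ, integral_gradSqX_resc hv hτ, ha, hb, hX]
    field_simp
  have hY' : (∫ p in Dom, grady (resc a τ u) p ^ 2) + (∫ p in Dom, grady (resc b τ v) p ^ 2)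
      = Y := by
    rw [integral_grady_sq_resc hu hτ, integral_grady_sq_resc hv hτ, ha, hb, hY]
    field_simp
  have hN' : ∫ p in Dom, nonlin (resc a τ u) (resc b τ v) p = τ ^ 3 * N := by
    rw [integral_nonlin hu' hv', integral_resc_pow hτ, integral_resc_pow hτ,
      integral_resc_sq_mul_sq hτ, ha, hb, ha4, hb4, hN]
    field_simp
  have hQ : svirial (resc a τ u) (resc b τ v) = 0 := by
    rw [svirial_eq hu' hv', hX', hN', hτdef]
    field_simp
    ring
  have hE : energy (resc a τ u) (resc b τ v) = (8 / 27) * (X ^ 3 / N ^ 2) + (1 / 2) * Y := by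
    rw [energy_eq hu' hv', hX', hY', hN', hτdef]
    field_simp
    ring
  rw [← hE]
  refine mlevel_le ⟨hu', (l2_eq_iff hΘ).2 ?_⟩ ⟨hv', (l2_eq_iff hΘ).2 ?_⟩ hQ
  · rw [integral_resc_pow hτ, ha, hk]
    field_simp
  · rw [integral_resc_pow hτ, hb, hvΘ]
    field_simp

end Functionals

section Variation

variable {u v φ : Pt → ℝ}

/-- A quadratic polynomial density integrates termwise. -/
lemma integral_quadratic {f g h F : Pt → ℝ} {s : ℝ} (hf : IntegrableOn f Dom)
    (hg : IntegrableOn g Dom) (hh : IntegrableOn h Dom)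
    (hF : ∀ p, F p = f p + 2 * s * g p + s ^ 2 * h p) :
    ∫ p in Dom, F p
      = (∫ p in Dom, f p) + 2 * s * (∫ p in Dom, g p) + s ^ 2 * ∫ p in Dom, h p := by
  rw [← integral_const_mul, ← integral_const_mul, ← integral_add hf (hg.const_mul _),
    ← integral_add (f := fun p => f p + 2 * s * g p) (hf.add (hg.const_mul _)) (hh.const_mul _)]
  simp only [hF]

lemma hasDerivAt_quadratic (a b c : ℝ) :
    HasDerivAt (fun s : ℝ => a + 2 * s * b + s ^ 2 * c) (2 * b) 0 := by
  have h1 := ((hasDerivAt_id (0 : ℝ)).const_mul 2).mul_const b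
  have h2 := ((hasDerivAt_id (0 : ℝ)).pow 2).mul_const c
  refine ((h1.const_add a).add h2).congr_deriv ?_
  simp

lemma hasDerivAt_integral_sq (hu : H1 u) (hφ : H1 φ) :
    HasDerivAt (fun s : ℝ => ∫ p in Dom, (u p + s * φ p) ^ 2)
      (2 * ∫ p in Dom, u p * φ p) 0 := by
  refine (hasDerivAt_quadratic (∫ p in Dom, u p ^ 2) _ (∫ p in Dom, φ p ^ 2)).congr_of_eventuallyEq
    (.of_forall fun s => ?_)
  exact integral_quadratic hu.memL2 (hu.integrable_mul hφ) hφ.memL2 fun p => by ring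

lemma hasDerivAt_integral_gradSqX (hu : H1 u) (hφ : H1 φ) :
    HasDerivAt (fun s : ℝ => ∫ p in Dom, gradSqX (fun q => u q + s * φ q) p)
      (2 * ∫ p in Dom, gradDotX u φ p) 0 := by
  refine (hasDerivAt_quadratic (∫ p in Dom, gradSqX u p) _
    (∫ p in Dom, gradSqX φ p)).congr_of_eventuallyEq (.of_forall fun s => ?_)
  exact integral_quadratic hu.integrable_gradSqX (hu.integrable_gradDotX hφ)
    hφ.integrable_gradSqX fun p => gradSqX_add_smul hu.diff hφ.diff s p

lemma hasDerivAt_integral_grady_sq (hu : H1 u) (hφ : H1 φ) :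
    HasDerivAt (fun s : ℝ => ∫ p in Dom, grady (fun q => u q + s * φ q) p ^ 2)
      (2 * ∫ p in Dom, grady u p * grady φ p) 0 := by
  refine (hasDerivAt_quadratic (∫ p in Dom, grady u p ^ 2) _
    (∫ p in Dom, grady φ p ^ 2)).congr_of_eventuallyEq (.of_forall fun s => ?_)
  exact integral_quadratic hu.integrable_grady_sq (hu.integrable_grady_mul hφ)
    hφ.integrable_grady_sq fun p => by rw [grady_add_smul hu.diff hφ.diff]; ring

lemma hasDerivAt_integral_sq_mul_sq (hu : H1 u) (hv : H1 v) (hφ : H1 φ) :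
    HasDerivAt (fun s : ℝ => ∫ p in Dom, (u p + s * φ p) ^ 2 * v p ^ 2)
      (2 * ∫ p in Dom, u p * φ p * (v p * v p)) 0 := by
  refine (hasDerivAt_quadratic (∫ p in Dom, u p ^ 2 * v p ^ 2) _
    (∫ p in Dom, φ p ^ 2 * v p ^ 2)).congr_of_eventuallyEq (.of_forall fun s => ?_)
  exact integral_quadratic (hu.integrable_sq_mul_sq hv) (hu.integrable_mul_mul hφ hv hv)
    (hφ.integrable_sq_mul_sq hv) fun p => by ring

lemma hasDerivAt_integral_pow_four (hu : H1 u) (hφ : H1 φ) :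
    HasDerivAt (fun s : ℝ => ∫ p in Dom, (u p + s * φ p) ^ 4)
      (4 * ∫ p in Dom, u p * u p * (u p * φ p)) 0 := by
  have i1 := hu.integrable_mul_mul hu hu hφ
  have i2 := hu.integrable_mul_mul hu hφ hφ
  have i3 := hu.integrable_mul_mul hφ hφ hφ
  have key : ∀ s : ℝ, ∫ p in Dom, (u p + s * φ p) ^ 4
      = (∫ p in Dom, u p ^ 4) + 2 * s * (2 * ∫ p in Dom, u p * u p * (u p * φ p))
        + s ^ 2 * ∫ p in Dom, (6 * (u p * u p * (φ p * φ p))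
          + 4 * s * (u p * φ p * (φ p * φ p)) + s ^ 2 * φ p ^ 4) := fun s => by
    rw [← integral_const_mul 2]
    exact integral_quadratic hu.memL4 (i1.const_mul 2)
      (((i2.const_mul 6).add (i3.const_mul (4 * s))).add (hφ.memL4.const_mul (s ^ 2)))
      fun p => by ring
  have key' : ∀ s : ℝ, ∫ p in Dom, (6 * (u p * u p * (φ p * φ p))
          + 4 * s * (u p * φ p * (φ p * φ p)) + s ^ 2 * φ p ^ 4)
      = (∫ p in Dom, 6 * (u p * u p * (φ p * φ p)))
        + 2 * s * (∫ p in Dom, 2 * (u p * φ p * (φ p * φ p)))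
        + s ^ 2 * ∫ p in Dom, φ p ^ 4 := fun s =>
    integral_quadratic (i2.const_mul 6) (i3.const_mul 2) hφ.memL4 fun p => by ring
  simp only [key, key']
  have h1 := (hasDerivAt_quadratic (∫ p in Dom, u p ^ 4)
    (2 * ∫ p in Dom, u p * u p * (u p * φ p)) 0)
  have h2 := ((hasDerivAt_id (0 : ℝ)).pow 2).mul (hasDerivAt_quadratic
    (∫ p in Dom, 6 * (u p * u p * (φ p * φ p))) (∫ p in Dom, 2 * (u p * φ p * (φ p * φ p)))
    (∫ p in Dom, φ p ^ 4))
  refine ((h1.add h2).congr_deriv ?_).congr_of_eventuallyEq (.of_forall fun s => ?_)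
  · simp
    ring
  · simp

lemma integral_pow_four_pos (hu : H1 u) (h : 0 < ∫ p in Dom, u p ^ 2) :
    0 < ∫ p in Dom, u p ^ 4 := by
  have h0 : (0 : Pt → ℝ) ≤ fun p => u p ^ 4 := fun p => by positivity
  refine lt_of_le_of_ne (integral_nonneg h0) fun h4 => h.ne' ?_
  have hae := (integral_eq_zero_iff_of_nonneg h0 hu.memL4).1 h4.symm
  refine integral_eq_zero_of_ae (hae.mono fun p hp => ?_)
  have : u p = 0 := by simpa using hp
  simp [this]

/-- The Euler–Lagrange equation in the first component. -/
lemma isMinimizer.exists_weakSol {Θ : ℝ} (hΘ : 0 < Θ) (h : isMinimizer Θ u v) :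
    ∃ lam : ℝ, WeakSol lam u (fun p => u p ^ 3 + u p * v p ^ 2) := by
  obtain ⟨⟨hu, huΘ⟩, hvS, hQ, hE⟩ := h
  have hv := hvS.1
  rw [l2_eq_iff hΘ] at huΘ
  have hM0 : 0 < ∫ p in Dom, u p ^ 2 := huΘ ▸ by positivity
  rw [svirial_eq hu hv, integral_nonlin hu hv] at hQ
  rw [energy_eq hu hv, integral_nonlin hu hv] at hE
  have hU4 := integral_pow_four_pos hu hM0
  have hV4 : 0 ≤ ∫ p in Dom, v p ^ 4 := integral_nonneg fun p => by positivity
  have hUV : 0 ≤ ∫ p in Dom, u p ^ 2 * v p ^ 2 := integral_nonneg fun p => by positivity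
  refine ⟨-(1 / Θ ^ 2) * ((∫ p in Dom, gradSqX u p) + (∫ p in Dom, grady u p ^ 2)
    - (∫ p in Dom, u p ^ 4) - ∫ p in Dom, u p ^ 2 * v p ^ 2), fun φ hφT => ?_⟩
  have hφ := hφT.h1
  have dM := hasDerivAt_integral_sq hu hφ
  have dX := hasDerivAt_integral_gradSqX hu hφ
  have dY := hasDerivAt_integral_grady_sq hu hφ
  have dP := hasDerivAt_integral_pow_four hu hφ
  have dR := hasDerivAt_integral_sq_mul_sq hu hv hφ
  -- the left and right hand sides of the weak formulation, split into elementary integrals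
  have hL : ∀ lam : ℝ, ∫ p in Dom, ((∑ i, gradx u p i * gradx φ p i)
      + grady u p * grady φ p + lam * u p * φ p)
      = (∫ p in Dom, gradDotX u φ p) + (∫ p in Dom, grady u p * grady φ p)
        + lam * ∫ p in Dom, u p * φ p := fun lam => by
    rw [← integral_const_mul, ← integral_add (hu.integrable_gradDotX hφ)
      (hu.integrable_grady_mul hφ), ← integral_add
      (f := fun p => gradDotX u φ p + grady u p * grady φ p) ((hu.integrable_gradDotX hφ).add
      (hu.integrable_grady_mul hφ)) ((hu.integrable_mul hφ).const_mul lam)]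
    simp only [gradDotX, mul_assoc]
  have hR : ∫ p in Dom, (u p ^ 3 + u p * v p ^ 2) * φ p
      = (∫ p in Dom, u p * u p * (u p * φ p)) + ∫ p in Dom, u p * φ p * (v p * v p) := by
    rw [← integral_add (hu.integrable_mul_mul hu hu hφ) (hu.integrable_mul_mul hφ hv hv)]
    congr 1
    ext p
    ring
  rw [hL, hR]
  obtain ⟨M, hMdef⟩ : ∃ M : ℝ → ℝ, M = fun s => ∫ p in Dom, (u p + s * φ p) ^ 2 := ⟨_, rfl⟩
  obtain ⟨X, hXdef⟩ : ∃ X : ℝ → ℝ,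
    X = fun s => ∫ p in Dom, gradSqX (fun q => u q + s * φ q) p := ⟨_, rfl⟩
  obtain ⟨Y, hYdef⟩ : ∃ Y : ℝ → ℝ,
    Y = fun s => ∫ p in Dom, grady (fun q => u q + s * φ q) p ^ 2 := ⟨_, rfl⟩
  obtain ⟨P, hPdef⟩ : ∃ P : ℝ → ℝ, P = fun s => ∫ p in Dom, (u p + s * φ p) ^ 4 := ⟨_, rfl⟩
  obtain ⟨R, hRdef⟩ : ∃ R : ℝ → ℝ,
    R = fun s => ∫ p in Dom, (u p + s * φ p) ^ 2 * v p ^ 2 := ⟨_, rfl⟩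
  rw [← hMdef] at dM
  rw [← hXdef] at dX
  rw [← hYdef] at dY
  rw [← hPdef] at dP
  rw [← hRdef] at dR
  have eM : M 0 = Θ ^ 2 := by simp [hMdef, huΘ]
  have eX : ∫ p in Dom, gradSqX u p = X 0 := by simp [hXdef]
  have eY : ∫ p in Dom, grady u p ^ 2 = Y 0 := by simp [hYdef]
  have eP : ∫ p in Dom, u p ^ 4 = P 0 := by simp [hPdef]
  have eR : ∫ p in Dom, u p ^ 2 * v p ^ 2 = R 0 := by simp [hRdef]
  rw [eX, eP, eR] at hQ
  rw [eX, eY, eP, eR] at hE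
  rw [eX, eY, eP, eR]
  rw [eP] at hU4
  rw [eR] at hUV
  have dk := (hasDerivAt_const (0 : ℝ) (Θ ^ 2)).div dM (by rw [eM]; positivity)
  obtain ⟨k, hkdef⟩ : ∃ k : ℝ → ℝ, k = fun s => Θ ^ 2 / M s := ⟨_, rfl⟩
  have ek : k 0 = 1 := by
    simp only [hkdef, eM]
    field_simp
  replace dk : HasDerivAt k (-(2 * ∫ p in Dom, u p * φ p) / Θ ^ 2) 0 := by
    rw [hkdef]
    refine dk.congr_deriv ?_
    rw [eM]
    field_simp
    ring
  have dXX := (dk.mul dX).add_const (∫ p in Dom, gradSqX v p)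
  have dYY := (dk.mul dY).add_const (∫ p in Dom, grady v p ^ 2)
  have dNN := (((dk.pow 2).mul dP).add ((dk.const_mul 2).mul dR)).add_const (∫ p in Dom, v p ^ 4)
  obtain ⟨XX, hXX⟩ : ∃ F : ℝ → ℝ, F = fun s => k s * X s + ∫ p in Dom, gradSqX v p := ⟨_, rfl⟩
  obtain ⟨YY, hYY⟩ : ∃ F : ℝ → ℝ, F = fun s => k s * Y s + ∫ p in Dom, grady v p ^ 2 := ⟨_, rfl⟩
  obtain ⟨NN, hNN⟩ : ∃ F : ℝ → ℝ,
    F = fun s => k s ^ 2 * P s + 2 * k s * R s + ∫ p in Dom, v p ^ 4 := ⟨_, rfl⟩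
  have eXX : XX 0 = (3 / 4) * NN 0 := by
    simp only [hXX, hNN, ek]
    linarith
  have hN0 : 0 < NN 0 := by
    simp only [hNN, ek]
    linarith
  have hX0 : 0 < XX 0 := by linarith
  replace dXX := dXX.congr_of_eventuallyEq (.of_forall fun s => congrFun hXX s)
  replace dYY := dYY.congr_of_eventuallyEq (.of_forall fun s => congrFun hYY s)
  replace dNN := dNN.congr_of_eventuallyEq (.of_forall fun s => congrFun hNN s)
  have dG := (((dXX.pow 3).div (dNN.pow 2) (by simp [hN0.ne'])).const_mul (8 / 27)).add
    (dYY.const_mul (1 / 2))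
  have hmin : IsLocalMin (fun s => (8 / 27) * (XX s ^ 3 / NN s ^ 2) + (1 / 2) * YY s) 0 := by
    filter_upwards [dM.continuousAt.eventually
        (lt_mem_nhds (a := 0) (by rw [eM]; positivity)),
      dXX.continuousAt.eventually (lt_mem_nhds hX0),
      dNN.continuousAt.eventually (lt_mem_nhds hN0)] with s hMs hXs hNs
    have hle := mlevel_le_quotient hΘ (hu.add_smul hφ s) hvS (k := k s) (X := XX s) (Y := YY s)
      (N := NN s) (by simpa [hMdef] using hMs) (by simp [hkdef, hMdef]) (by simp [hXX, hXdef])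
      (by simp [hYY, hYdef]) (by simp [hNN, hPdef, hRdef]) hXs hNs
    refine le_trans (le_of_eq ?_) hle
    rw [← hE, eXX]
    have hq : (3 / 4 * NN 0) ^ 3 / NN 0 ^ 2 = (27 / 64) * NN 0 := by
      field_simp
      ring
    rw [hq]
    simp only [hNN, hYY, ek]
    linarith
  have hzero := hmin.hasDerivAt_eq_zero dG
  simp only [Pi.pow_apply, eXX, ek] at hzero
  have hN0' := hN0.ne'
  generalize NN 0 = n at hzero hN0'
  push_cast at hzero
  field_simp at hzero ⊢
  norm_num at hzero
  linear_combination (1 / 1728) * hzero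

end Variation

/-- any minimizer of `m_Θ` is a weak solution of the coupled system for
suitable Lagrange multipliers `λ₁, λ₂`. -/
theorem minimizer_is_weak_solution (Θ : ℝ) (hΘ : 0 < Θ) (u v : Pt → ℝ)
    (h : isMinimizer Θ u v) :
    ∃ lam1 lam2 : ℝ,
      WeakSol lam1 u (fun p => (u p) ^ 3 + u p * (v p) ^ 2) ∧
      WeakSol lam2 v (fun p => (v p) ^ 3 + v p * (u p) ^ 2) := by
  obtain ⟨hu, hv, hQ, hE⟩ := h
  obtain ⟨lam1, h1⟩ := isMinimizer.exists_weakSol hΘ ⟨hu, hv, hQ, hE⟩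
  obtain ⟨lam2, h2⟩ := isMinimizer.exists_weakSol hΘ
    (⟨hv, hu, svirial_comm u v ▸ hQ, energy_comm u v ▸ hE⟩ : isMinimizer Θ v u)
  exact ⟨lam1, lam2, h1, h2⟩

end Waveguide
end
end

section
/- Suppose that for each μ > 0 the pair (u_μ, v_μ) is a minimizer of m_{1,μ}, i.e. (u_μ, v_μ) ∈ S₁ × S₁ with Q(u_μ, v_μ) = 0 and J_μ(u_μ, v_μ) = m_{1,μ}. Then μ·∫_{ℝ³×𝕋}(|(u_μ)_y|² + |(v_μ)_y|²) dx dy → 0 as μ → ∞. -/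
noncomputable section

open MeasureTheory Real Filter

namespace Waveguide

/-! ### Level comparison between different values of `μ` -/

lemma H1.integrableOn_grady_sq {u : Pt → ℝ} (hu : H1 u) :
    IntegrableOn (fun p => (grady u p) ^ 2) Dom := by
  refine Integrable.mono' hu.memGrad
    ((measurable_fderiv_apply_const ℝ u ey).pow_const 2).aestronglyMeasurable
    (Eventually.of_forall fun p => ?_)
  rw [Real.norm_of_nonneg (sq_nonneg _)]
  exact le_add_of_nonneg_left (Finset.sum_nonneg fun i _ => sq_nonneg _)

lemma H1.integrableOn_gradSqX {u : Pt → ℝ} (hu : H1 u) : IntegrableOn (gradSqX u) Dom := by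
  refine (hu.memGrad.sub hu.integrableOn_grady_sq).congr (Eventually.of_forall fun p => ?_)
  simp [gradSq]

/-- On the constraint `Q = 0` the functional `J_μ` is a sum of nonnegative gradient terms. -/
lemma Jfun_eq_of_svirial_eq_zero {u v : Pt → ℝ} (hu : H1 u) (hv : H1 v) (hQ : svirial u v = 0)
    (μ : ℝ) :
    Jfun μ u v = (1 / 6) * (∫ p in Dom, (gradSqX u p + gradSqX v p))
      + μ / 2 * ∫ p in Dom, ((grady u p) ^ 2 + (grady v p) ^ 2) := by
  have hx := hu.integrableOn_gradSqX.add hv.integrableOn_gradSqX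
  have hy := (hu.integrableOn_grady_sq.add hv.integrableOn_grady_sq).const_mul μ
  have hsplit : (∫ p in Dom,
      (gradSqX u p + μ * (grady u p) ^ 2 + gradSqX v p + μ * (grady v p) ^ 2))
      = (∫ p in Dom, (gradSqX u p + gradSqX v p))
        + μ * ∫ p in Dom, ((grady u p) ^ 2 + (grady v p) ^ 2) := by
    rw [← integral_const_mul]
    refine Eq.trans ?_ (integral_add hx hy)
    congr 1 with p
    ring
  unfold svirial at hQ
  unfold Jfun
  rw [hsplit]
  linarith

lemma m1_le {μ : ℝ} (hμ : 0 < μ) {u v : Pt → ℝ} (hu : inS 1 u) (hv : inS 1 v)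
    (hQ : svirial u v = 0) : m1 μ ≤ Jfun μ u v := by
  refine csInf_le ⟨0, ?_⟩ ⟨u, v, hu, hv, hQ, rfl⟩
  rintro c ⟨u, v, hu, hv, hQ, rfl⟩
  rw [Jfun_eq_of_svirial_eq_zero hu.1 hv.1 hQ]
  have hx : 0 ≤ ∫ p in Dom, (gradSqX u p + gradSqX v p) := integral_nonneg fun p =>
    add_nonneg (Finset.sum_nonneg fun i _ => sq_nonneg _) (Finset.sum_nonneg fun i _ => sq_nonneg _)
  have hy : 0 ≤ ∫ p in Dom, ((grady u p) ^ 2 + (grady v p) ^ 2) := integral_nonneg fun p => by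
    positivity
  positivity

/-- A minimizer for `μ`, used as a competitor for `ν`. -/
lemma isMinimizerJ.m1_add_le {μ ν : ℝ} (hν : 0 < ν) {u v : Pt → ℝ} (h : isMinimizerJ μ u v) :
    m1 ν + (μ - ν) / 2 * ∫ p in Dom, ((grady u p) ^ 2 + (grady v p) ^ 2) ≤ m1 μ := by
  obtain ⟨hu, hv, hQ, hJ⟩ := h
  have hle := m1_le hν hu hv hQ
  rw [Jfun_eq_of_svirial_eq_zero hu.1 hv.1 hQ] at hle hJ
  linarith

/-! ### Gaussian integrals on `ℝ³` -/

lemma integrable_sq_mul_exp_neg_mul_sq {b : ℝ} (hb : 0 < b) :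
    Integrable fun x : ℝ => x ^ 2 * exp (-b * x ^ 2) := by
  simpa using integrable_rpow_mul_exp_neg_mul_sq hb (s := 2) (by norm_num)

lemma integral_sq_mul_exp_neg_mul_sq {b : ℝ} (hb : 0 < b) :
    ∫ x : ℝ, x ^ 2 * exp (-b * x ^ 2) = √(π / b) / (2 * b) := by
  have hd : ∀ x : ℝ, HasDerivAt (fun x => x * exp (-b * x ^ 2))
      (exp (-b * x ^ 2) - 2 * b * (x ^ 2 * exp (-b * x ^ 2))) x := fun x => by
    refine ((hasDerivAt_id x).mul (((hasDerivAt_pow 2 x).const_mul (-b)).exp)).congr_deriv ?_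
    simp
    ring
  have h2 := (integrable_sq_mul_exp_neg_mul_sq hb).const_mul (2 * b)
  have hzero := integral_eq_zero_of_hasDerivAt_of_integrable hd
    ((integrable_exp_neg_mul_sq hb).sub h2) (integrable_mul_exp_neg_mul_sq hb)
  rw [integral_sub (integrable_exp_neg_mul_sq hb) h2, integral_const_mul, integral_gaussian]
    at hzero
  rw [eq_div_iff (by positivity)]
  linarith

lemma exp_neg_mul_sum_sq (b : ℝ) (x : Pt3) :
    exp (-b * ∑ i, x i ^ 2) = ∏ i, exp (-b * x i ^ 2) := by
  rw [Finset.mul_sum, exp_sum]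

lemma sq_mul_exp_neg_mul_sum_sq (b : ℝ) (j : Fin 3) (x : Pt3) :
    x j ^ 2 * exp (-b * ∑ i, x i ^ 2)
      = ∏ i, (if i = j then x i ^ 2 else 1) * exp (-b * x i ^ 2) := by
  rw [exp_neg_mul_sum_sq, Finset.prod_mul_distrib, Finset.prod_ite_eq' Finset.univ j]
  simp

lemma integrable_exp_neg_mul_sum_sq {b : ℝ} (hb : 0 < b) :
    Integrable fun x : Pt3 => exp (-b * ∑ i, x i ^ 2) := by
  simp_rw [exp_neg_mul_sum_sq]
  exact Integrable.fintype_prod fun _ => integrable_exp_neg_mul_sq hb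

lemma integral_exp_neg_mul_sum_sq (b : ℝ) :
    ∫ x : Pt3, exp (-b * ∑ i, x i ^ 2) = √(π / b) ^ 3 := by
  simp_rw [exp_neg_mul_sum_sq]
  rw [integral_fintype_prod_volume_eq_prod (fun (_ : Fin 3) (t : ℝ) => exp (-b * t ^ 2))]
  simp only [integral_gaussian, Finset.prod_const, Finset.card_univ, Fintype.card_fin]

lemma integrable_sq_mul_exp_neg_mul_sum_sq {b : ℝ} (hb : 0 < b) (j : Fin 3) :
    Integrable fun x : Pt3 => x j ^ 2 * exp (-b * ∑ i, x i ^ 2) := by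
  simp_rw [sq_mul_exp_neg_mul_sum_sq]
  refine Integrable.fintype_prod
    (f := fun (i : Fin 3) (t : ℝ) => (if i = j then t ^ 2 else 1) * exp (-b * t ^ 2)) fun i => ?_
  by_cases hij : i = j
  · simpa [hij] using integrable_sq_mul_exp_neg_mul_sq hb
  · simpa [hij] using integrable_exp_neg_mul_sq hb

lemma integral_sq_mul_exp_neg_mul_sum_sq {b : ℝ} (hb : 0 < b) (j : Fin 3) :
    ∫ x : Pt3, x j ^ 2 * exp (-b * ∑ i, x i ^ 2) = √(π / b) ^ 3 / (2 * b) := by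
  simp_rw [sq_mul_exp_neg_mul_sum_sq]
  rw [integral_fintype_prod_volume_eq_prod
    (fun (i : Fin 3) (t : ℝ) => (if i = j then t ^ 2 else 1) * exp (-b * t ^ 2))]
  have hfac : ∀ i : Fin 3, ∫ t : ℝ, (if i = j then t ^ 2 else 1) * exp (-b * t ^ 2)
      = (if i = j then 1 / (2 * b) else 1) * √(π / b) := fun i => by
    by_cases hij : i = j
    · simp only [hij, if_true, integral_sq_mul_exp_neg_mul_sq hb]
      ring
    · simp only [hij, if_false, one_mul, integral_gaussian]
  simp_rw [hfac]
  rw [Finset.prod_mul_distrib, Finset.prod_ite_eq' Finset.univ j]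
  simp
  ring

/-! ### A `y`-independent competitor -/

lemma volume_restrict_Dom :
    (volume : Measure Pt).restrict Dom
      = (volume : Measure Pt3).prod (volume.restrict (Set.Ioc 0 (2 * π))) := by
  rw [Dom, Measure.volume_eq_prod, ← Measure.prod_restrict, Measure.restrict_univ]

lemma integrableOn_Dom_comp_fst {f : Pt3 → ℝ} (hf : Integrable f) :
    IntegrableOn (fun p : Pt => f p.1) Dom := by
  rw [IntegrableOn, volume_restrict_Dom]
  exact hf.comp_fst _

lemma integral_Dom_comp_fst (f : Pt3 → ℝ) :
    ∫ p in Dom, f (Prod.fst p) = 2 * π * ∫ x, f x := by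
  rw [volume_restrict_Dom, integral_fun_fst]
  simp [Measure.real, pi_pos.le]

/-- The Gaussian `c exp(-a|x|²)` on the waveguide. -/
def gaussian (a c : ℝ) : Pt → ℝ := fun p => c * exp (-a * ∑ i, p.1 i ^ 2)

lemma hasFDerivAt_gaussian (a c : ℝ) (p : Pt) :
    HasFDerivAt (gaussian a c) (gaussian a c p •
      (-a) • ∑ i, (2 * p.1 i) • (ContinuousLinearMap.proj (R := ℝ) (φ := fun _ : Fin 3 => ℝ) i).comp
        (ContinuousLinearMap.fst ℝ Pt3 ℝ)) p := by
  have hi : ∀ i : Fin 3, HasFDerivAt (fun p : Pt => p.1 i ^ 2)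
      ((2 * p.1 i) • (ContinuousLinearMap.proj (R := ℝ) (φ := fun _ : Fin 3 => ℝ) i).comp
        (ContinuousLinearMap.fst ℝ Pt3 ℝ)) p := fun i => by
    have := ((ContinuousLinearMap.proj (R := ℝ) (φ := fun _ : Fin 3 => ℝ) i).comp
        (ContinuousLinearMap.fst ℝ Pt3 ℝ)).hasFDerivAt (x := p)
    exact (this.pow 2).congr_fderiv (by simp)
  have hsum := HasFDerivAt.fun_sum (u := Finset.univ) fun i _ => hi i
  refine (((hsum.const_mul (-a)).exp).const_mul c).congr_fderiv ?_
  simp only [gaussian, smul_smul, mul_assoc]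

lemma gradx_gaussian (a c : ℝ) (p : Pt) (i : Fin 3) :
    gradx (gaussian a c) p i = -2 * a * p.1 i * gaussian a c p := by
  rw [gradx, (hasFDerivAt_gaussian a c p).fderiv]
  simp [ex]
  ring

lemma grady_gaussian (a c : ℝ) (p : Pt) : grady (gaussian a c) p = 0 := by
  rw [grady, (hasFDerivAt_gaussian a c p).fderiv]
  simp [ey]

lemma gaussian_pow (a c : ℝ) (n : ℕ) (p : Pt) :
    gaussian a c p ^ n = c ^ n * exp (-(n * a) * ∑ i, p.1 i ^ 2) := by
  rw [gaussian, mul_pow, ← exp_nat_mul]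
  congr 2
  ring

lemma gradSqX_gaussian (a c : ℝ) (p : Pt) :
    gradSqX (gaussian a c) p
      = 4 * a ^ 2 * c ^ 2 * ∑ j, p.1 j ^ 2 * exp (-(2 * a) * ∑ i, p.1 i ^ 2) := by
  have h2 := gaussian_pow a c 2 p
  push_cast at h2
  simp only [gradSqX, gradx_gaussian, Finset.mul_sum, mul_pow]
  refine Finset.sum_congr rfl fun j _ => ?_
  rw [h2]
  simp only [Finset.mul_sum]
  ring

lemma H1_gaussian {a : ℝ} (ha : 0 < a) (c : ℝ) : H1 (gaussian a c) where
  periodic _ _ := rfl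
  diff p := (hasFDerivAt_gaussian a c p).differentiableAt
  memL2 := by
    simp_rw [gaussian_pow]
    exact integrableOn_Dom_comp_fst
      ((integrable_exp_neg_mul_sum_sq (by positivity : 0 < ((2 : ℕ) : ℝ) * a)).const_mul (c ^ 2))
  memGrad := by
    simp_rw [gradSq, grady_gaussian, gradSqX_gaussian]
    simpa using integrableOn_Dom_comp_fst ((integrable_finsetSum Finset.univ fun j _ =>
      integrable_sq_mul_exp_neg_mul_sum_sq (by positivity : 0 < 2 * a) j).const_mul
        (4 * a ^ 2 * c ^ 2))
  memL4 := by
    simp_rw [gaussian_pow]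
    exact integrableOn_Dom_comp_fst
      ((integrable_exp_neg_mul_sum_sq (by positivity : 0 < ((4 : ℕ) : ℝ) * a)).const_mul (c ^ 4))

lemma integral_gaussian_pow (a c : ℝ) (n : ℕ) :
    ∫ p in Dom, gaussian a c p ^ n = 2 * π * (c ^ n * √(π / (n * a)) ^ 3) := by
  simp_rw [gaussian_pow]
  rw [integral_Dom_comp_fst fun x => c ^ n * exp (-(n * a) * ∑ i, x i ^ 2), integral_const_mul,
    integral_exp_neg_mul_sum_sq]

lemma integral_gradSqX_gaussian {a : ℝ} (ha : 0 < a) (c : ℝ) :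
    ∫ p in Dom, gradSqX (gaussian a c) p = 6 * π * a * c ^ 2 * √(π / (2 * a)) ^ 3 := by
  have h2a : 0 < 2 * a := by positivity
  simp_rw [gradSqX_gaussian]
  rw [integral_Dom_comp_fst fun x =>
      4 * a ^ 2 * c ^ 2 * ∑ j, x j ^ 2 * exp (-(2 * a) * ∑ i, x i ^ 2),
    integral_const_mul, integral_finsetSum _ fun j _ =>
      integrable_sq_mul_exp_neg_mul_sum_sq h2a j]
  simp_rw [integral_sq_mul_exp_neg_mul_sum_sq h2a]
  simp
  field_simp
  ring

/-- The constraint set of `m_{1,μ}` contains a `y`-independent pair. -/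
lemma exists_constraint_grady_eq_zero :
    ∃ u : Pt → ℝ, inS 1 u ∧ svirial u u = 0 ∧ ∀ p, grady u p = 0 := by
  have hπ := pi_pos
  obtain ⟨a, ha_def⟩ : ∃ a, a = 16 * π ^ 5 := ⟨_, rfl⟩
  have ha : 0 < a := by rw [ha_def]; positivity
  have h2a : 0 < π / (2 * a) := by positivity
  obtain ⟨s, hs_def⟩ : ∃ s, s = √(π / (2 * a)) := ⟨_, rfl⟩
  have hs : 0 < s := hs_def ▸ sqrt_pos.2 h2a
  have hs2 : s ^ 2 = 1 / (32 * π ^ 4) := by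
    rw [hs_def, sq_sqrt h2a.le, ha_def]
    field_simp
    norm_num
  have hs4 : √(π / (4 * a)) = 1 / (8 * π ^ 2) := by
    rw [sqrt_eq_iff_mul_self_eq (by positivity) (by positivity), ha_def]
    field_simp
    norm_num
  obtain ⟨c, hc_def⟩ : ∃ c, c = √(1 / (2 * π * s ^ 3)) := ⟨_, rfl⟩
  have hc2 : c ^ 2 = 1 / (2 * π * s ^ 3) := hc_def ▸ sq_sqrt (by positivity)
  have hc4 : c ^ 4 = 8192 * π ^ 10 := by
    calc c ^ 4 = (c ^ 2) ^ 2 := by ring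
      _ = 1 / (4 * π ^ 2 * (s ^ 2) ^ 3) := by rw [hc2]; field_simp; norm_num
      _ = 8192 * π ^ 10 := by rw [hs2]; field_simp; norm_num
  have hu := H1_gaussian ha c
  refine ⟨gaussian a c, ⟨hu, ?_⟩, ?_, grady_gaussian a c⟩
  · rw [l2, integral_gaussian_pow, Nat.cast_ofNat, ← hs_def, hc2, sqrt_eq_one]
    field_simp
  · have hN : ∀ p, nonlin (gaussian a c) (gaussian a c) p = 4 * gaussian a c p ^ 4 := fun p => by
      unfold nonlin
      ring
    simp_rw [svirial, hN]
    rw [integral_add hu.integrableOn_gradSqX hu.integrableOn_gradSqX, integral_const_mul,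
      integral_gaussian_pow, integral_gradSqX_gaussian ha, Nat.cast_ofNat, hs4, ← hs_def, hc2, hc4,
      ha_def]
    field_simp
    ring

lemma exists_forall_m1_le : ∃ C, ∀ μ, 0 < μ → m1 μ ≤ C := by
  obtain ⟨u, hu, hQ, hy⟩ := exists_constraint_grady_eq_zero
  refine ⟨(1 / 6) * ∫ p in Dom, (gradSqX u p + gradSqX u p), fun μ hμ => ?_⟩
  refine (m1_le hμ hu hu hQ).trans_eq ?_
  rw [Jfun_eq_of_svirial_eq_zero hu.1 hu.1 hQ]
  simp [hy]

/-- if `(u_μ, v_μ)` is a minimizer of `m_{1,μ}` for each `μ > 0`, then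
`μ ∫ (|（u_μ)_y|² + |(v_μ)_y|²) → 0` as `μ → ∞`. -/
theorem vanishing_weighted_y_derivative (U V : ℝ → Pt → ℝ)
    (h : ∀ μ : ℝ, 0 < μ → isMinimizerJ μ (U μ) (V μ)) :
    Filter.Tendsto
      (fun μ : ℝ => μ * ∫ p in Dom, ((grady (U μ) p) ^ 2 + (grady (V μ) p) ^ 2))
      Filter.atTop (nhds 0) := by
  set B : ℝ → ℝ := fun μ => ∫ p in Dom, ((grady (U μ) p) ^ 2 + (grady (V μ) p) ^ 2) with hB
  have hB0 : ∀ μ, 0 ≤ B μ := fun μ => integral_nonneg fun p => by positivity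
  have hkey : ∀ μ ν, 0 < μ → 0 < ν → m1 ν + (μ - ν) / 2 * B μ ≤ m1 μ :=
    fun μ ν hμ hν => (h μ hμ).m1_add_le hν
  have hmono : Monotone fun μ => m1 (max μ 1) := fun ν μ hνμ => by
    have hmax := max_le_max_right (1 : ℝ) hνμ
    have := hkey (max μ 1) (max ν 1) (by positivity) (by positivity)
    have := mul_nonneg (by linarith : 0 ≤ (max μ 1 - max ν 1) / 2) (hB0 (max μ 1))
    dsimp only
    linarith
  obtain ⟨C, hC⟩ := exists_forall_m1_le
  have hlim := tendsto_atTop_ciSup hmono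
    ⟨C, by rintro _ ⟨μ, rfl⟩; exact hC _ (by positivity)⟩
  have hdiff := ((hlim.sub (hlim.comp (tendsto_id.atTop_div_const (zero_lt_two' ℝ)))).const_mul 4)
  rw [sub_self, mul_zero] at hdiff
  refine tendsto_of_tendsto_of_tendsto_of_le_of_le' tendsto_const_nhds hdiff ?_ ?_
  · filter_upwards [eventually_ge_atTop 0] with μ hμ using mul_nonneg hμ (hB0 μ)
  · filter_upwards [eventually_ge_atTop 2] with μ hμ
    have := hkey μ (μ / 2) (by linarith) (by linarith)
    simp only [Function.comp_apply, id]
    rw [max_eq_left (by linarith), max_eq_left (by linarith)]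
    linarith

end Waveguide
end
end
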